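/- arXiv:1903.07957 — 3 statements merged into one kernel-verified Lean document; each statement's English description precedes it below -/
import Mathlib

section
/- There exists a constant C > 0 such that for all sufficiently large n, the number of prefix normal binary words of length n is at least 2^(n − C·(log n)²). -/
/-- Number of ones of the infinite binary word `w` in the 0-indexed
half-open interval of positions `[a, b)`. Thus `cnt w j (j+k)` is the number
of 1s in the subword `w[j+1, j+k]` (1-indexed), and `cnt w 0 k` is the number
of 1s in the prefix of length `k`. -/
def cnt (w : ℕ → Bool) (a b : ℕ) : ℕ :=
  ((Finset.Ico a b).filter (fun i => w i = true)).card

/-- Extend a binary word of length `n` to an infinite word by `false`s. -/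
def ext {n : ℕ} (w : Fin n → Bool) : ℕ → Bool :=
  fun i => if h : i < n then w ⟨i, h⟩ else false

/-- A binary word of length `n` is prefix normal if the number of 1s in any
subword is at most the number of 1s in the prefix of the same length:
`|w[1,k]|₁ ≥ |w[j+1,j+k]|₁` for all `0 ≤ k ≤ n`, `0 ≤ j ≤ n - k`. -/
def IsPrefixNormal (n : ℕ) (w : ℕ → Bool) : Prop :=
  ∀ k j : ℕ, k ≤ n → j + k ≤ n → cnt w j (j + k) ≤ cnt w 0 k

open Real
open Finset hiding ext

/-- The sign `1` or `-1` of a bit. -/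
def bitSign (b : Bool) : ℝ := if b = true then 1 else -1

/-- The weight of `w` under the product measure with independent signs of mean `s i`. -/
noncomputable def tiltedWeight (n : ℕ) (s : ℕ → ℝ) (w : Fin n → Bool) : ℝ :=
  ∏ i : Fin n, (1 + s i * bitSign (w i)) / 2

/-- A bias profile whose first `T` entries are `1` and whose later partial sums grow
like `a * √k`. -/
noncomputable def sqrtBias (a : ℝ) (T : ℕ) (i : ℕ) : ℝ :=
  if i < T then 1 else a * (√((i : ℝ) + 1) - √(i : ℝ))

lemma sum_words_prod (n : ℕ) (h : Fin n → Bool → ℝ) :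
    ∑ w : Fin n → Bool, ∏ i, h i (w i) = ∏ i, (h i true + h i false) := by
  have := Finset.prod_univ_sum (fun _ : Fin n => (Finset.univ : Finset Bool)) h
  simp only [Fintype.sum_bool, Fintype.piFinset_univ] at this
  exact this.symm

lemma sum_tiltedWeight (n : ℕ) (s : ℕ → ℝ) : ∑ w, tiltedWeight n s w = 1 := by
  unfold tiltedWeight
  rw [sum_words_prod n (fun i b => (1 + s i * bitSign b) / 2)]
  refine Finset.prod_eq_one fun i _ => ?_
  simp only [bitSign]
  norm_num
  ring

lemma tiltedWeight_nonneg {n : ℕ} {s : ℕ → ℝ} (h0 : ∀ i, 0 ≤ s i) (h1 : ∀ i, s i ≤ 1)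
    (w : Fin n → Bool) : 0 ≤ tiltedWeight n s w := by
  refine Finset.prod_nonneg fun i _ => ?_
  have := h0 i
  have := h1 i
  unfold bitSign
  split_ifs <;> linarith

lemma sum_tiltedWeight_sq_le (n : ℕ) (s : ℕ → ℝ) :
    ∑ w, tiltedWeight n s w ^ 2 ≤ (1 / 2) ^ n * exp (∑ i ∈ range n, s i ^ 2) := by
  simp only [tiltedWeight, ← Finset.prod_pow]
  rw [sum_words_prod n (fun i b => ((1 + s i * bitSign b) / 2) ^ 2),
    ← Fin.sum_univ_eq_sum_range (fun i => s i ^ 2), exp_sum]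
  have hc : ((1 : ℝ) / 2) ^ n = ∏ _i : Fin n, (1 / 2 : ℝ) := by simp
  rw [hc, ← Finset.prod_mul_distrib]
  refine Finset.prod_le_prod (fun i _ => by positivity) fun i _ => ?_
  have := add_one_le_exp (s i ^ 2)
  simp only [bitSign]
  norm_num
  linarith

lemma exp_le_one_add_add_sq {y : ℝ} (hy : |y| ≤ 1) : exp y ≤ 1 + y + y ^ 2 := by
  have := abs_exp_sub_one_sub_id_le hy
  linarith [(abs_le.mp this).2]

lemma sum_tiltedWeight_mul_exp_le {n : ℕ} {s : ℕ → ℝ} (h0 : ∀ i, 0 ≤ s i) (h1 : ∀ i, s i ≤ 1)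
    (c : ℕ → ℝ) (hc : ∀ i, |c i| ≤ 1) :
    ∑ w, tiltedWeight n s w * exp (∑ i : Fin n, c i * bitSign (w i)) ≤
      exp (∑ i ∈ range n, (c i * s i + c i ^ 2)) := by
  simp only [tiltedWeight, exp_sum, ← Finset.prod_mul_distrib]
  rw [sum_words_prod n (fun i b => (1 + s i * bitSign b) / 2 * exp (c i * bitSign b)),
    ← Fin.prod_univ_eq_prod_range (fun i => exp (c i * s i + c i ^ 2))]
  have hb : ∀ i : ℕ, 0 ≤ (1 + s i) / 2 ∧ 0 ≤ (1 - s i) / 2 := fun i =>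
    ⟨by linarith [h0 i], by linarith [h1 i]⟩
  refine Finset.prod_le_prod (fun i _ => ?_) fun i _ => ?_
  · have := hb i
    simp only [bitSign]
    norm_num
    have e1 := exp_pos (c i)
    have e2 := exp_pos (-c i)
    nlinarith [mul_nonneg this.1 e1.le, mul_nonneg this.2 e2.le]
  · have hp := exp_le_one_add_add_sq (hc i)
    have hm := exp_le_one_add_add_sq (y := -c i) (by rw [abs_neg]; exact hc i)
    have := add_one_le_exp (c i * s i + c i ^ 2)
    simp only [bitSign]
    norm_num
    nlinarith [mul_le_mul_of_nonneg_left hp (hb i).1, mul_le_mul_of_nonneg_left hm (hb i).2]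

lemma cnt_add (w : ℕ → Bool) {a b c : ℕ} (hab : a ≤ b) (hbc : b ≤ c) :
    cnt w a b + cnt w b c = cnt w a c := by
  unfold cnt
  rw [← Finset.Ico_union_Ico_eq_Ico hab hbc, Finset.filter_union,
    Finset.card_union_of_disjoint]
  exact Finset.disjoint_filter_filter (Finset.Ico_disjoint_Ico_consecutive a b c)

lemma exists_disjoint_of_not_isPrefixNormal {n : ℕ} {w : ℕ → Bool}
    (h : ¬ IsPrefixNormal n w) :
    ∃ k j, k ≤ j ∧ j + k ≤ n ∧ cnt w 0 k < cnt w j (j + k) := by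
  unfold IsPrefixNormal at h
  push Not at h
  obtain ⟨k, j, _, hjk, hlt⟩ := h
  rcases le_total k j with hkj | hkj
  · exact ⟨k, j, hkj, hjk, hlt⟩
  · refine ⟨j, k, hkj, by omega, ?_⟩
    have h1 := cnt_add w (Nat.zero_le j) hkj
    have h2 := cnt_add w hkj (Nat.le_add_left k j)
    rw [add_comm k j]
    omega

lemma sum_bitSign_Ico (w : ℕ → Bool) (a k : ℕ) :
    ∑ i ∈ Ico a (a + k), bitSign (w i) = 2 * (cnt w a (a + k) : ℝ) - k := by
  have h : ∀ b, bitSign b = 2 * (if b = true then 1 else 0) - 1 := by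
    intro b
    cases b <;> norm_num [bitSign]
  simp only [h, Finset.sum_sub_distrib, ← Finset.mul_sum, cnt, Finset.sum_boole]
  simp

/-- The signed indicator of the window `[j, j + k)` against the prefix `[0, k)`. -/
def windowCoeff (k j i : ℕ) : ℝ :=
  (if i ∈ Ico j (j + k) then 1 else 0) - (if i ∈ Ico 0 k then 1 else 0)

lemma sum_windowCoeff_mul {n k j : ℕ} (hj : j + k ≤ n) (g : ℕ → ℝ) :
    ∑ i ∈ range n, windowCoeff k j i * g i =
      ∑ i ∈ Ico j (j + k), g i - ∑ i ∈ range k, g i := by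
  simp only [windowCoeff, sub_mul, ite_mul, one_mul, zero_mul, Finset.sum_sub_distrib]
  rw [← Finset.sum_filter, ← Finset.sum_filter]
  congr 2 <;> ext i <;> simp <;> omega

lemma windowCoeff_sq {k j : ℕ} (hk : k ≤ j) (i : ℕ) :
    windowCoeff k j i ^ 2 =
      (if i ∈ Ico j (j + k) then 1 else 0) + (if i ∈ Ico 0 k then 1 else 0) := by
  unfold windowCoeff
  by_cases h1 : i ∈ Ico j (j + k) <;> by_cases h2 : i ∈ Ico 0 k <;> simp only [h1, h2] <;>
    norm_num
  simp at h1 h2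
  omega

lemma abs_windowCoeff_le (k j i : ℕ) : |windowCoeff k j i| ≤ 1 := by
  unfold windowCoeff
  split_ifs <;> norm_num

lemma sum_windowCoeff_sq {n k j : ℕ} (hk : k ≤ j) (hj : j + k ≤ n) :
    ∑ i ∈ range n, windowCoeff k j i ^ 2 = 2 * k := by
  simp only [windowCoeff_sq hk, Finset.sum_add_distrib, Finset.sum_boole]
  have h1 : (range n).filter (fun i => i ∈ Ico j (j + k)) = Ico j (j + k) := by
    ext i; simp; omega
  have h2 : (range n).filter (fun i => i ∈ Ico 0 k) = Ico 0 k := by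
    ext i; simp; omega
  rw [h1, h2]
  simp
  ring

lemma sum_windowCoeff_bitSign_nonneg {n k j : ℕ} (hj : j + k ≤ n)
    {w : Fin n → Bool} (h : cnt (ext w) 0 k < cnt (ext w) j (j + k)) :
    0 ≤ ∑ i : Fin n, windowCoeff k j i * bitSign (w i) := by
  have hw : ∀ i : Fin n, w i = ext w i := fun i => by simp [ext]
  simp only [hw]
  rw [Fin.sum_univ_eq_sum_range (fun i => windowCoeff k j i * bitSign (ext w i)),
    sum_windowCoeff_mul hj (fun i => bitSign (ext w i)), sum_bitSign_Ico]
  have h0 := sum_bitSign_Ico (ext w) 0 k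
  rw [zero_add, ← Finset.range_eq_Ico] at h0
  rw [h0]
  have : (cnt (ext w) 0 k : ℝ) ≤ cnt (ext w) j (j + k) := by exact_mod_cast h.le
  linarith

section SqrtBias

variable {a : ℝ} {T : ℕ}

lemma sqrt_succ_sub_sqrt_le (i : ℕ) : √((i : ℝ) + 1) - √(i : ℝ) ≤ 1 / √((i : ℝ) + 1) := by
  have h : 0 < √((i : ℝ) + 1) := by positivity
  rw [le_div_iff₀ h]
  have h1 := mul_self_sqrt (show (0 : ℝ) ≤ (i : ℝ) + 1 by positivity)
  have h2 := mul_self_sqrt (show (0 : ℝ) ≤ (i : ℝ) by positivity)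
  have h3 : √(i : ℝ) ≤ √((i : ℝ) + 1) := sqrt_le_sqrt (by linarith)
  nlinarith [sqrt_nonneg (i : ℝ)]

lemma sqrtBias_nonneg (ha : 0 ≤ a) (i : ℕ) : 0 ≤ sqrtBias a T i := by
  unfold sqrtBias
  split_ifs
  · norm_num
  · exact mul_nonneg ha (sub_nonneg.mpr (sqrt_le_sqrt (by linarith)))

lemma sqrtBias_sq_le (hT : (T : ℝ) ≤ a ^ 2 + 1) (i : ℕ) :
    sqrtBias a T i ^ 2 ≤ (a ^ 2 + 1) / ((i : ℝ) + 1) := by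
  have hi : (0 : ℝ) < (i : ℝ) + 1 := by positivity
  unfold sqrtBias
  split_ifs with h
  · rw [le_div_iff₀ hi]
    have : (i : ℝ) + 1 ≤ T := by exact_mod_cast h
    linarith
  · have h1 : 0 ≤ √((i : ℝ) + 1) - √(i : ℝ) := sub_nonneg.mpr (sqrt_le_sqrt (by linarith))
    have h2 := pow_le_pow_left₀ h1 (sqrt_succ_sub_sqrt_le i) 2
    rw [div_pow, sq_sqrt hi.le, one_pow] at h2
    calc (a * (√((i : ℝ) + 1) - √(i : ℝ))) ^ 2
        = a ^ 2 * (√((i : ℝ) + 1) - √(i : ℝ)) ^ 2 := by ring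
      _ ≤ a ^ 2 * (1 / ((i : ℝ) + 1)) := by gcongr
      _ = a ^ 2 / ((i : ℝ) + 1) := by ring
      _ ≤ (a ^ 2 + 1) / ((i : ℝ) + 1) := by gcongr; linarith

lemma sqrtBias_le_one (ha : 0 ≤ a) (hT : a ^ 2 ≤ T) (i : ℕ) : sqrtBias a T i ≤ 1 := by
  unfold sqrtBias
  split_ifs with h
  · exact le_rfl
  · have hi : 0 < √((i : ℝ) + 1) := by positivity
    have hTi : (T : ℝ) ≤ i := by exact_mod_cast not_lt.mp h
    have hai : a ≤ √((i : ℝ) + 1) := le_sqrt_of_sq_le (by linarith)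
    calc a * (√((i : ℝ) + 1) - √(i : ℝ)) ≤ a * (1 / √((i : ℝ) + 1)) := by
          gcongr
          exact sqrt_succ_sub_sqrt_le i
      _ = a / √((i : ℝ) + 1) := by ring
      _ ≤ 1 := (div_le_one hi).mpr hai

lemma sum_sqrtBias_Ico {j : ℕ} (hj : T ≤ j) (k : ℕ) :
    ∑ i ∈ Ico j (j + k), sqrtBias a T i = a * (√((j : ℝ) + k) - √(j : ℝ)) := by
  induction k with
  | zero => simp
  | succ k ih =>
    rw [← add_assoc, Finset.sum_Ico_succ_top (by omega), ih, sqrtBias, if_neg (by omega)]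
    push_cast
    rw [← add_assoc]
    ring

lemma le_sum_sqrtBias_range (hT : a ^ 2 ≤ T) {k : ℕ} (hk : T ≤ k) :
    a * √(k : ℝ) ≤ ∑ i ∈ range k, sqrtBias a T i := by
  have h1 : ∑ i ∈ range T, sqrtBias a T i = T := by
    rw [Finset.sum_congr rfl (g := fun _ => (1 : ℝ))]
    · simp
    · intro i hi
      simp [sqrtBias, Finset.mem_range.mp hi]
  obtain ⟨d, rfl⟩ := Nat.exists_eq_add_of_le hk
  rw [Finset.range_eq_Ico, ← Finset.sum_Ico_consecutive _ (Nat.zero_le T) hk,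
    ← Finset.range_eq_Ico, h1, sum_sqrtBias_Ico le_rfl]
  have h2 : a ≤ √(T : ℝ) := le_sqrt_of_sq_le hT
  have h3 := mul_self_sqrt (show (0 : ℝ) ≤ (T : ℝ) by positivity)
  push_cast
  nlinarith [mul_le_mul_of_nonneg_right h2 (sqrt_nonneg (T : ℝ))]

lemma sqrt_add_sub_sqrt_le {j k : ℝ} (hk : 0 < k) (hkj : k ≤ j) : √(j + k) - √j ≤ √k / 2 := by
  have h1 : √k ≤ √j := sqrt_le_sqrt hkj
  have h2 := mul_self_sqrt hk.le
  have h3 := mul_self_sqrt (hk.le.trans hkj)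
  have h0 := sqrt_nonneg k
  rw [sub_le_iff_le_add, sqrt_le_left (by positivity)]
  nlinarith

lemma sum_windowCoeff_sqrtBias_le (ha : 0 ≤ a) (hT : a ^ 2 ≤ T) {n k j : ℕ} (hTk : T ≤ k)
    (hk0 : 0 < k) (hk : k ≤ j) (hj : j + k ≤ n) :
    ∑ i ∈ range n, windowCoeff k j i * sqrtBias a T i ≤ -(a * √(k : ℝ) / 2) := by
  rw [sum_windowCoeff_mul hj, sum_sqrtBias_Ico (hTk.trans hk)]
  have h1 := le_sum_sqrtBias_range hT hTk
  have h2 : √((j : ℝ) + k) - √(j : ℝ) ≤ √(k : ℝ) / 2 :=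
    sqrt_add_sub_sqrt_le (by exact_mod_cast hk0) (by exact_mod_cast hk)
  nlinarith [mul_le_mul_of_nonneg_left h2 ha]

lemma sum_sqrtBias_sq_le (hT : (T : ℝ) ≤ a ^ 2 + 1) (n : ℕ) :
    ∑ i ∈ range n, sqrtBias a T i ^ 2 ≤ (a ^ 2 + 1) * (1 + log n) := by
  calc ∑ i ∈ range n, sqrtBias a T i ^ 2
      ≤ ∑ i ∈ range n, (a ^ 2 + 1) / ((i : ℝ) + 1) :=
        Finset.sum_le_sum fun i _ => sqrtBias_sq_le hT i
    _ = (a ^ 2 + 1) * (harmonic n : ℝ) := by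
        simp [harmonic, Finset.mul_sum, div_eq_mul_inv]
    _ ≤ _ := by
        gcongr
        exact harmonic_le_one_add_log n

/-- The probability that the window starting at `j` beats the prefix of length `k`. -/
lemma sum_tiltedWeight_window_le (ha : 0 < a) (hT : a ^ 2 ≤ T) {n k j : ℕ} (hTk : T ≤ k)
    (hk : k ≤ j) (hj : j + k ≤ n) :
    ∑ w : Fin n → Bool with cnt (ext w) 0 k < cnt (ext w) j (j + k),
      tiltedWeight n (sqrtBias a T) w ≤ exp (-(a ^ 2 / 32)) := by
  have haT : (a ^ 2 : ℝ) ≤ k := hT.trans (by exact_mod_cast hTk)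
  have hk0 : (0 : ℝ) < k := lt_of_lt_of_le (by positivity) haT
  have hr : 0 < √(k : ℝ) := sqrt_pos.mpr hk0
  have har : a ≤ √(k : ℝ) := le_sqrt_of_sq_le haT
  set l : ℝ := a / (8 * √(k : ℝ)) with hl
  have hl0 : 0 ≤ l := by positivity
  have hl1 : l ≤ 1 := by
    rw [hl, div_le_one (by positivity)]
    linarith
  have hlr : l * √(k : ℝ) = a / 8 := by
    rw [hl]
    field_simp
  have hlk : l ^ 2 * k = a ^ 2 / 64 := by
    rw [← sq_sqrt hk0.le, ← mul_pow, hlr]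
    ring
  have hnn := tiltedWeight_nonneg (n := n) (sqrtBias_nonneg (T := T) ha.le)
    (sqrtBias_le_one ha.le hT)
  calc _ ≤ ∑ w : Fin n → Bool, tiltedWeight n (sqrtBias a T) w *
          exp (∑ i : Fin n, (l * windowCoeff k j i) * bitSign (w i)) := by
        rw [Finset.sum_filter]
        refine Finset.sum_le_sum fun w _ => ?_
        split_ifs with h
        · refine le_mul_of_one_le_right (hnn w) (one_le_exp ?_)
          simp only [mul_assoc, ← Finset.mul_sum]
          exact mul_nonneg hl0 (sum_windowCoeff_bitSign_nonneg hj h)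
        · exact mul_nonneg (hnn w) (exp_pos _).le
    _ ≤ exp (∑ i ∈ range n, ((l * windowCoeff k j i) * sqrtBias a T i +
          (l * windowCoeff k j i) ^ 2)) := by
        refine sum_tiltedWeight_mul_exp_le (sqrtBias_nonneg ha.le) (sqrtBias_le_one ha.le hT)
          (fun i => l * windowCoeff k j i) fun i => ?_
        rw [abs_mul, abs_of_nonneg hl0]
        exact mul_le_one₀ hl1 (abs_nonneg _) (abs_windowCoeff_le k j i)
    _ ≤ _ := by
        rw [exp_le_exp]
        simp only [mul_assoc, mul_pow, Finset.sum_add_distrib, ← Finset.mul_sum]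
        rw [sum_windowCoeff_sq hk hj]
        have := mul_le_mul_of_nonneg_left
          (sum_windowCoeff_sqrtBias_le ha.le hT hTk (by exact_mod_cast hk0) hk hj) hl0
        nlinarith

lemma tiltedWeight_sqrtBias_eq_zero {n : ℕ} {w : Fin n → Bool} {i : Fin n} (hi : (i : ℕ) < T)
    (hw : w i = false) : tiltedWeight n (sqrtBias a T) w = 0 := by
  refine Finset.prod_eq_zero (Finset.mem_univ i) ?_
  simp [sqrtBias, hi, hw, bitSign]

lemma cnt_le_length (w : ℕ → Bool) (j k : ℕ) : cnt w j (j + k) ≤ k := by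
  unfold cnt
  exact (Finset.card_filter_le _ _).trans (by simp)

lemma exists_false_of_cnt_lt {n k : ℕ} {w : Fin n → Bool} (hk : k ≤ n)
    (h : cnt (ext w) 0 k < k) : ∃ i : Fin n, (i : ℕ) < k ∧ w i = false := by
  by_contra! hne
  refine h.ne ?_
  unfold cnt
  rw [Finset.filter_true_of_mem]
  · simp
  · intro i hi
    have hik : i < k := (Finset.mem_Ico.mp hi).2
    have := hne ⟨i, by omega⟩ hik
    simpa [ext, show i < n by omega] using this

open Classical in
lemma sum_tiltedWeight_not_isPrefixNormal_le (ha : 0 < a) (hT : a ^ 2 ≤ T) (n : ℕ) :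
    ∑ w : Fin n → Bool with ¬ IsPrefixNormal n (ext w), tiltedWeight n (sqrtBias a T) w ≤
      ((n : ℝ) + 1) ^ 2 * exp (-(a ^ 2 / 32)) := by
  have hnn := tiltedWeight_nonneg (n := n) (sqrtBias_nonneg (T := T) ha.le)
    (sqrtBias_le_one ha.le hT)
  set P := (range (n + 1) ×ˢ range (n + 1)).filter
    (fun p : ℕ × ℕ => T ≤ p.1 ∧ p.1 ≤ p.2 ∧ p.2 + p.1 ≤ n) with hP
  calc _ ≤ ∑ w : Fin n → Bool, ∑ p ∈ P,
          if cnt (ext w) 0 p.1 < cnt (ext w) p.2 (p.2 + p.1) then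
            tiltedWeight n (sqrtBias a T) w else 0 := by
        rw [Finset.sum_filter]
        refine Finset.sum_le_sum fun w _ => ?_
        have hterm : ∀ p ∈ P, 0 ≤ if cnt (ext w) 0 p.1 < cnt (ext w) p.2 (p.2 + p.1) then
            tiltedWeight n (sqrtBias a T) w else 0 := fun p _ => by
          split_ifs
          · exact hnn w
          · exact le_rfl
        by_cases h : IsPrefixNormal n (ext w)
        · rw [if_neg (not_not.mpr h)]
          exact Finset.sum_nonneg hterm
        · rw [if_pos h]
          obtain ⟨k, j, hkj, hjk, hlt⟩ := exists_disjoint_of_not_isPrefixNormal h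
          rcases le_or_gt T k with hTk | hTk
          · refine le_trans (le_of_eq ?_) (Finset.single_le_sum hterm
              (a := (k, j)) (by simp [hP]; omega))
            simp [hlt]
          · obtain ⟨i, hi, hwi⟩ := exists_false_of_cnt_lt (w := w) (k := k) (by omega)
              (hlt.trans_le (cnt_le_length _ j k))
            rw [tiltedWeight_sqrtBias_eq_zero (hi.trans hTk) hwi]
            simp
    _ = ∑ p ∈ P, ∑ w : Fin n → Bool with
          cnt (ext w) 0 p.1 < cnt (ext w) p.2 (p.2 + p.1),
            tiltedWeight n (sqrtBias a T) w := by
        rw [Finset.sum_comm]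
        simp only [Finset.sum_filter]
    _ ≤ ∑ _p ∈ P, exp (-(a ^ 2 / 32)) := by
        refine Finset.sum_le_sum fun p hp => ?_
        obtain ⟨_, h1, h2, h3⟩ := Finset.mem_filter.mp hp
        exact sum_tiltedWeight_window_le ha hT h1 h2 h3
    _ ≤ _ := by
        rw [Finset.sum_const, nsmul_eq_mul]
        gcongr
        have : P.card ≤ (n + 1) ^ 2 := by
          refine (Finset.card_filter_le _ _).trans ?_
          simp [sq]
        exact_mod_cast this

end SqrtBias

open Classical in
lemma card_isPrefixNormal_ge {n : ℕ} {a : ℝ} (ha : 0 < a)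
    (hn : ((n : ℝ) + 1) ^ 2 * exp (-(a ^ 2 / 32)) ≤ 1 / 2) :
    2 ^ n * exp (-((a ^ 2 + 1) * (1 + log n))) / 4 ≤
      (Set.ncard {w : Fin n → Bool | IsPrefixNormal n (ext w)} : ℝ) := by
  set T := ⌈a ^ 2⌉₊
  have hT : a ^ 2 ≤ T := Nat.le_ceil _
  have hT' : (T : ℝ) ≤ a ^ 2 + 1 := (Nat.ceil_lt_add_one (by positivity)).le
  set A := (univ : Finset (Fin n → Bool)).filter (fun w => IsPrefixNormal n (ext w)) with hA
  have hcard : Set.ncard {w : Fin n → Bool | IsPrefixNormal n (ext w)} = A.card := by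
    rw [← Set.ncard_coe_finset]
    simp [hA]
  rw [hcard]
  set μ := tiltedWeight n (sqrtBias a T)
  have hhalf : 1 / 2 ≤ ∑ w ∈ A, μ w := by
    have h1 : ∑ w ∈ A, μ w + ∑ w with ¬ IsPrefixNormal n (ext w), μ w = ∑ w, μ w :=
      Finset.sum_filter_add_sum_filter_not _ _ _
    have h2 := sum_tiltedWeight_not_isPrefixNormal_le ha hT n
    have h3 : ∑ w, μ w = 1 := sum_tiltedWeight n _
    linarith
  have hcs : (∑ w ∈ A, μ w) ^ 2 ≤ A.card * ∑ w ∈ A, μ w ^ 2 := sq_sum_le_card_mul_sum_sq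
  have hsq : ∑ w ∈ A, μ w ^ 2 ≤ (1 / 2) ^ n * exp ((a ^ 2 + 1) * (1 + log n)) := by
    refine (Finset.sum_le_univ_sum_of_nonneg fun w => sq_nonneg (μ w)).trans ?_
    refine (sum_tiltedWeight_sq_le n _).trans ?_
    gcongr
    exact sum_sqrtBias_sq_le hT' n
  have hfin : 1 / 4 ≤ (A.card : ℝ) * ((1 / 2) ^ n * exp ((a ^ 2 + 1) * (1 + log n))) := by
    calc (1 / 4 : ℝ) = (1 / 2) ^ 2 := by norm_num
      _ ≤ (∑ w ∈ A, μ w) ^ 2 := by gcongr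
      _ ≤ _ := hcs.trans (by gcongr)
  rw [exp_neg]
  have hE := exp_pos ((a ^ 2 + 1) * (1 + log n))
  rw [one_div_pow] at hfin
  have h2n : (0 : ℝ) < 2 ^ n := by positivity
  field_simp at hfin ⊢
  linarith

/-- There exists a constant `C > 0` such that for all sufficiently large `n`,
the number of prefix normal binary words of length `n` is at least
`2 ^ (n - C * (log n)^2)`. -/
theorem prefix_normal_count_lower_bound :
    ∃ C : ℝ, 0 < C ∧ ∀ᶠ n : ℕ in Filter.atTop,
      (2 : ℝ) ^ ((n : ℝ) - C * (Real.log n) ^ 2) ≤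
        (Set.ncard {w : Fin n → Bool | IsPrefixNormal n (ext w)} : ℝ) := by
  refine ⟨400, by norm_num, ?_⟩
  have hlog : ∀ᶠ n : ℕ in Filter.atTop, (2 : ℝ) ≤ log n :=
    (tendsto_log_atTop.comp tendsto_natCast_atTop_atTop).eventually_ge_atTop 2
  filter_upwards [hlog, Filter.eventually_ge_atTop 3] with n hL hn3
  have hn : (3 : ℝ) ≤ n := by exact_mod_cast hn3
  have hn0 : (0 : ℝ) < n := by linarith
  set L := log n
  have ha : 0 < √(128 * L) := sqrt_pos.mpr (by linarith)
  have ha2 : √(128 * L) ^ 2 = 128 * L := sq_sqrt (by linarith)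
  have hexp : exp (-(√(128 * L) ^ 2 / 32)) = ((n : ℝ) ^ 4)⁻¹ := by
    rw [ha2, exp_neg, show 128 * L / 32 = (4 : ℕ) * L by push_cast; ring, exp_nat_mul,
      exp_log hn0]
  have hsmall : ((n : ℝ) + 1) ^ 2 * exp (-(√(128 * L) ^ 2 / 32)) ≤ 1 / 2 := by
    rw [hexp, ← div_eq_mul_inv, div_le_iff₀ (by positivity)]
    nlinarith [mul_self_nonneg ((n : ℝ) ^ 2 - 9), mul_self_nonneg ((n : ℝ) - 3)]
  refine le_trans ?_ (card_isPrefixNormal_ge ha hsmall)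
  rw [ha2, rpow_sub (by norm_num), rpow_natCast, div_eq_mul_inv, mul_div_assoc,
    ← rpow_neg (by norm_num), rpow_def_of_pos (by norm_num)]
  gcongr
  have h4 : exp (-2) ≤ 1 / 4 := by
    rw [exp_neg, ← one_div]
    gcongr
    have := add_one_le_exp (1 : ℝ)
    rw [show (2 : ℝ) = 1 + 1 by norm_num, exp_add]
    nlinarith
  have hl2 := log_two_gt_d9
  calc exp (log 2 * -(400 * L ^ 2)) ≤ exp (-((128 * L + 1) * (1 + L)) + -2) := by
        rw [exp_le_exp]
        nlinarith [mul_le_mul_of_nonneg_right hl2.le (sq_nonneg L)]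
    _ = exp (-((128 * L + 1) * (1 + L))) * exp (-2) := exp_add _ _
    _ ≤ exp (-((128 * L + 1) * (1 + L))) * (1 / 4) := by gcongr
    _ = _ := by ring
end

section
/- There exists a constant c > 0 such that for all sufficiently large n, the number of prefix normal binary words of length n is at most 2^(n − c·(log n)²). -/
/-- The value `±1` attached to a letter. -/
def spin (b : Bool) : ℝ := cond b 1 (-1)

lemma sum_spin_succ (m : ℕ) (F : ℝ → ℝ) :
    ∑ v : Fin (m + 1) → Bool, F (∑ i, spin (v i)) =
      ∑ v : Fin m → Bool, (F (1 + ∑ i, spin (v i)) + F (-1 + ∑ i, spin (v i))) := by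
  rw [← (Fin.consEquiv fun _ => Bool).sum_comp, Fintype.sum_prod_type, Fintype.sum_bool,
    ← Finset.sum_add_distrib]
  simp [Fin.consEquiv, Fin.sum_univ_succ, spin]

lemma spin_moments (m : ℕ) :
    ∑ v : Fin m → Bool, (∑ i, spin (v i)) = 0 ∧
    ∑ v : Fin m → Bool, (∑ i, spin (v i)) ^ 2 = m * 2 ^ m ∧
    ∑ v : Fin m → Bool, (∑ i, spin (v i)) ^ 3 = 0 ∧
    ∑ v : Fin m → Bool, (∑ i, spin (v i)) ^ 4 = (3 * m ^ 2 - 2 * m) * 2 ^ m := by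
  induction m with
  | zero => simp
  | succ m ih =>
    obtain ⟨h1, h2, h3, h4⟩ := ih
    have hc : ∑ _v : Fin m → Bool, (1 : ℝ) = 2 ^ m := by simp
    refine ⟨?_, ?_, ?_, ?_⟩
    · rw [sum_spin_succ m fun x => x]
      calc _ = 2 * ∑ v : Fin m → Bool, (∑ i, spin (v i)) := by
            rw [Finset.mul_sum]; exact Finset.sum_congr rfl fun _ _ => by ring
        _ = 0 := by rw [h1]; ring
    · rw [sum_spin_succ m fun x => x ^ 2]
      calc _ = 2 * ∑ v : Fin m → Bool, (∑ i, spin (v i)) ^ 2 + 2 * ∑ _v : Fin m → Bool, 1 := by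
            simp only [Finset.mul_sum, ← Finset.sum_add_distrib]
            exact Finset.sum_congr rfl fun _ _ => by ring
        _ = _ := by rw [h2, hc]; push_cast; ring
    · rw [sum_spin_succ m fun x => x ^ 3]
      calc _ = 2 * ∑ v : Fin m → Bool, (∑ i, spin (v i)) ^ 3 +
              6 * ∑ v : Fin m → Bool, (∑ i, spin (v i)) := by
            simp only [Finset.mul_sum, ← Finset.sum_add_distrib]
            exact Finset.sum_congr rfl fun _ _ => by rw [← Finset.mul_sum]; ring
        _ = _ := by rw [h1, h3]; ring
    · rw [sum_spin_succ m fun x => x ^ 4]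
      calc _ = 2 * ∑ v : Fin m → Bool, (∑ i, spin (v i)) ^ 4 +
              12 * ∑ v : Fin m → Bool, (∑ i, spin (v i)) ^ 2 + 2 * ∑ _v : Fin m → Bool, 1 := by
            simp only [Finset.mul_sum, ← Finset.sum_add_distrib]
            exact Finset.sum_congr rfl fun _ _ => by ring
        _ = _ := by rw [h2, h4, hc]; push_cast; ring

/-- Words of length `m` whose sum of spins is at least `t`. -/
noncomputable def heavy (m : ℕ) (t : ℝ) : Finset (Fin m → Bool) :=
  Finset.univ.filter fun v => t ≤ ∑ i, spin (v i)

lemma two_pow_le_card_heavy (m : ℕ) (r : ℝ) (hr : 0 < r) (hm : (m : ℝ) = r ^ 2) :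
    (2 : ℝ) ^ m ≤ 80 * (heavy m (r / 2)).card := by
  obtain ⟨h1, h2, h3, h4⟩ := spin_moments m
  have hc : ∑ _v : Fin m → Bool, (1 : ℝ) = 2 ^ m := by simp
  have key : ∀ s : ℝ, -((s - r / 2) * (s - 4 * r) * (s + r) ^ 2) ≤
      80 * r ^ 4 * (if r / 2 ≤ s then 1 else 0) := by
    intro s
    split_ifs with h
    · rcases le_total s (4 * r) with h' | h'
      · have e1 : (s - r / 2) * (4 * r - s) ≤ 49 / 16 * r ^ 2 := by
          nlinarith [sq_nonneg (s - 9 / 4 * r)]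
        have e2 : (s + r) ^ 2 ≤ 25 * r ^ 2 := by nlinarith
        have e3 : (s - r / 2) * (4 * r - s) * (s + r) ^ 2 ≤ 49 / 16 * r ^ 2 * (25 * r ^ 2) :=
          mul_le_mul e1 e2 (sq_nonneg _) (by positivity)
        nlinarith [pow_pos hr 4]
      · have : 0 ≤ (s - r / 2) * (s - 4 * r) * (s + r) ^ 2 :=
          mul_nonneg (mul_nonneg (by linarith) (by linarith)) (sq_nonneg _)
        nlinarith [pow_pos hr 4]
    · have : 0 ≤ (r / 2 - s) * (4 * r - s) * (s + r) ^ 2 :=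
        mul_nonneg (mul_nonneg (by linarith) (by linarith)) (sq_nonneg _)
      nlinarith
  have hsum := Finset.sum_le_sum fun (v : Fin m → Bool) (_ : v ∈ Finset.univ) =>
    key (∑ i, spin (v i))
  rw [← Finset.mul_sum, Finset.sum_boole] at hsum
  have hl : ∑ v : Fin m → Bool, -((∑ i, spin (v i) - r / 2) * (∑ i, spin (v i) - 4 * r) *
      (∑ i, spin (v i) + r) ^ 2) = (r ^ 4 + 2 * r ^ 2) * 2 ^ m := by
    calc _ = -∑ v : Fin m → Bool, (∑ i, spin (v i)) ^ 4
          + 5 / 2 * r * ∑ v : Fin m → Bool, (∑ i, spin (v i)) ^ 3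
          + 6 * r ^ 2 * ∑ v : Fin m → Bool, (∑ i, spin (v i)) ^ 2
          + 1 / 2 * r ^ 3 * ∑ v : Fin m → Bool, (∑ i, spin (v i))
          - 2 * r ^ 4 * ∑ _v : Fin m → Bool, 1 := by
            simp only [Finset.mul_sum, ← Finset.sum_add_distrib, ← Finset.sum_neg_distrib,
              ← Finset.sum_sub_distrib]
            exact Finset.sum_congr rfl fun _ _ => by rw [← Finset.mul_sum]; ring
      _ = _ := by rw [h1, h2, h3, h4, hc, hm]; ring
  rw [hl] at hsum
  have h5 : r ^ 4 * 2 ^ m ≤ r ^ 4 * (80 * (heavy m (r / 2)).card) := by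
    have : (0 : ℝ) ≤ 2 * r ^ 2 * 2 ^ m := by positivity
    unfold heavy
    nlinarith
  exact le_of_mul_le_mul_left h5 (by positivity)

lemma card_heavy_pow_le (L m : ℕ) (t : ℝ) :
    (heavy m t).card ^ L ≤ (heavy (L * m) (L * t)).card := by
  classical
  have h := Finset.card_le_card_of_injOn
    (s := Fintype.piFinset fun _ : Fin L => heavy m t) (t := heavy (L * m) (L * t))
    (fun f x => f (finProdFinEquiv.symm x).1 (finProdFinEquiv.symm x).2) ?_ ?_
  · simpa using h
  · intro f hf
    simp only [Finset.mem_coe, Fintype.mem_piFinset, heavy, Finset.mem_filter,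
      Finset.mem_univ, true_and] at hf ⊢
    rw [← finProdFinEquiv.sum_comp, Fintype.sum_prod_type]
    simp only [Equiv.symm_apply_apply]
    calc (L : ℝ) * t = ∑ _j : Fin L, t := by simp
      _ ≤ _ := Finset.sum_le_sum fun j _ => hf j
  · intro f _ g _ hfg
    funext j i
    simpa using congrFun hfg (finProdFinEquiv (j, i))

lemma ext_apply {n : ℕ} (w : Fin n → Bool) (x : Fin n) : ext w x = w x := by
  simp [ext]

open Classical in
lemma card_no_heavy_block (n k J : ℕ) (t p : ℝ) (hkJ : J * k ≤ n)
    (hp : p * 2 ^ k ≤ (heavy k t).card) :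
    ((Finset.univ.filter fun w : Fin n → Bool =>
      ∀ j < J, ∑ i ∈ Finset.range k, spin (ext w (j * k + i)) < t).card : ℝ) ≤
      2 ^ n * Real.exp (-(p * J)) := by
  obtain ⟨r, rfl⟩ := Nat.exists_eq_add_of_le hkJ
  have h := Finset.card_le_card_of_injOn
    (s := Finset.univ.filter fun w : Fin (J * k + r) → Bool =>
      ∀ j < J, ∑ i ∈ Finset.range k, spin (ext w (j * k + i)) < t)
    (t := (Fintype.piFinset fun _ : Fin J => (heavy k t)ᶜ) ×ˢ
      (Finset.univ : Finset (Fin r → Bool)))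
    (fun w => (fun j i => ext w (j * k + i), fun i => ext w (J * k + i))) ?_ ?_
  · rw [Finset.card_product, Fintype.card_piFinset_const] at h
    have hc : (((heavy k t)ᶜ.card : ℕ) : ℝ) ≤ 2 ^ k * Real.exp (-p) := by
      rw [Finset.card_compl, Nat.cast_sub (Finset.card_le_univ _)]
      have h1 : (2 : ℝ) ^ k * (-p + 1) ≤ 2 ^ k * Real.exp (-p) :=
        mul_le_mul_of_nonneg_left (Real.add_one_le_exp _) (by positivity)
      simp only [Fintype.card_pi, Fintype.card_bool, Finset.prod_const, Finset.card_univ,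
        Fintype.card_fin, Nat.cast_pow, Nat.cast_ofNat]
      linarith
    calc _ ≤ (((heavy k t)ᶜ.card ^ J * 2 ^ r : ℕ) : ℝ) := by
          refine Nat.cast_le.mpr (h.trans (le_of_eq ?_))
          simp
      _ ≤ (2 ^ k * Real.exp (-p)) ^ J * 2 ^ r := by
          push_cast
          gcongr
      _ = _ := by
          rw [mul_pow, ← Real.exp_nat_mul, pow_add, mul_comm J k, pow_mul]
          ring_nf
  · intro w hw
    simp only [Finset.coe_filter, Finset.mem_univ, true_and, Set.mem_ofPred_eq] at hw
    simp only [Finset.coe_product, Finset.coe_univ, Set.mem_prod, Finset.mem_coe,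
      Fintype.mem_piFinset, Set.mem_univ, and_true, heavy, Finset.mem_compl, Finset.mem_filter,
      Finset.mem_univ, true_and, not_le]
    intro j
    have := hw j j.2
    rwa [Finset.sum_range] at this
  · intro w _ w' _ hww
    simp only [Prod.mk.injEq] at hww
    obtain ⟨h1, h2⟩ := hww
    funext x
    rw [← ext_apply w, ← ext_apply w']
    rcases lt_or_ge (x : ℕ) (J * k) with hx | hx
    · have hk : 0 < k := Nat.pos_of_ne_zero fun h0 => by simp [h0] at hx
      have := congrFun (congrFun h1 ⟨x / k, (Nat.div_lt_iff_lt_mul hk).mpr hx⟩)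
        ⟨x % k, Nat.mod_lt _ hk⟩
      simpa [Nat.div_add_mod'] using this
    · have := congrFun h2 ⟨x - J * k, by omega⟩
      simpa [Nat.add_sub_cancel' hx] using this

lemma sum_exp_spin_le (n : ℕ) (a : Fin n → ℝ) :
    ∑ w : Fin n → Bool, Real.exp (∑ x, a x * spin (w x)) ≤
      2 ^ n * Real.exp ((∑ x, a x ^ 2) / 2) := by
  calc _ = ∏ x, ∑ b : Bool, Real.exp (a x * spin b) := by
        rw [Finset.prod_univ_sum, Fintype.piFinset_univ]
        exact Finset.sum_congr rfl fun w _ => Real.exp_sum _ _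
    _ ≤ ∏ x, 2 * Real.exp (a x ^ 2 / 2) := by
        refine Finset.prod_le_prod (fun x _ => by positivity) fun x _ => ?_
        have := Real.cosh_le_exp_half_sq (a x)
        rw [Real.cosh_eq] at this
        simp only [Fintype.sum_bool, spin, cond_true, cond_false, mul_one, mul_neg]
        linarith
    _ = _ := by
        rw [Finset.prod_mul_distrib, ← Real.exp_sum, Finset.sum_div]
        simp

lemma card_weighted_sum_ge (n : ℕ) (a : Fin n → ℝ) (T V l : ℝ) (hl : 0 ≤ l)
    (hV : ∑ x, a x ^ 2 ≤ V) :
    ((Finset.univ.filter fun w : Fin n → Bool => T ≤ ∑ x, a x * spin (w x)).card : ℝ) ≤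
      2 ^ n * Real.exp (l ^ 2 * V / 2 - l * T) := by
  have h1 := sum_exp_spin_le n fun x => l * a x
  have h2 : ((Finset.univ.filter fun w : Fin n → Bool =>
      T ≤ ∑ x, a x * spin (w x)).card : ℝ) * Real.exp (l * T) ≤
      ∑ w : Fin n → Bool, Real.exp (∑ x, l * a x * spin (w x)) := by
    rw [← nsmul_eq_mul, ← Finset.sum_const]
    refine (Finset.sum_le_sum fun w hw => ?_).trans
      (Finset.sum_le_sum_of_subset_of_nonneg (Finset.filter_subset _ _)
        fun _ _ _ => (Real.exp_pos _).le)
    rw [Real.exp_le_exp]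
    simp only [mul_assoc, ← Finset.mul_sum]
    exact mul_le_mul_of_nonneg_left (Finset.mem_filter.mp hw).2 hl
  have h3 : Real.exp ((∑ x, (l * a x) ^ 2) / 2) ≤ Real.exp (l ^ 2 * V / 2) := by
    rw [Real.exp_le_exp]
    simp only [mul_pow, ← Finset.mul_sum]
    gcongr
  rw [Real.exp_sub, mul_div_assoc', le_div_iff₀ (Real.exp_pos _)]
  exact h2.trans (h1.trans (by gcongr))

lemma sum_Ico_half_pow_le (m L : ℕ) :
    ∑ i ∈ Finset.Ico m L, (1 / 2 : ℝ) ^ i ≤ 2 * (1 / 2) ^ m := by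
  rcases le_total m L with h | h
  · have : ∑ i ∈ Finset.Ico m L, (1 / 2 : ℝ) ^ i = 2 * (1 / 2) ^ m - 2 * (1 / 2) ^ L := by
      induction L, h using Nat.le_induction with
      | base => simp
      | succ L hL ih => rw [Finset.sum_Ico_succ_top hL, ih]; ring
    rw [this]
    have : (0 : ℝ) < (1 / 2) ^ L := by positivity
    linarith
  · rw [Finset.Ico_eq_empty_of_le h]
    simp

lemma sq_sum_half_pow_le (A : Finset ℕ) :
    (∑ i ∈ A, (1 / 2 : ℝ) ^ i) ^ 2 ≤ 4 * ∑ i ∈ A, (1 / 4 : ℝ) ^ i := by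
  rcases A.eq_empty_or_nonempty with rfl | hA
  · simp
  have h1 : ∑ i ∈ A, (1 / 2 : ℝ) ^ i ≤ 2 * (1 / 2) ^ A.min' hA := by
    refine le_trans ?_ (sum_Ico_half_pow_le (A.min' hA) (A.max' hA + 1))
    refine Finset.sum_le_sum_of_subset_of_nonneg (fun i hi => ?_) fun _ _ _ => by positivity
    exact Finset.mem_Ico.mpr ⟨A.min'_le i hi, Nat.lt_succ_of_le (A.le_max' i hi)⟩
  have h2 : (1 / 4 : ℝ) ^ A.min' hA ≤ ∑ i ∈ A, (1 / 4 : ℝ) ^ i :=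
    Finset.single_le_sum (f := fun i => (1 / 4 : ℝ) ^ i) (fun _ _ => by positivity)
      (A.min'_mem hA)
  calc _ ≤ (2 * (1 / 2 : ℝ) ^ A.min' hA) ^ 2 :=
        pow_le_pow_left₀ (Finset.sum_nonneg fun _ _ => by positivity) h1 2
    _ = 4 * (1 / 4 : ℝ) ^ A.min' hA := by
        rw [mul_pow, ← pow_mul, mul_comm _ 2, pow_mul]; norm_num
    _ ≤ _ := by linarith

lemma sum_spin_eq_cnt (w : ℕ → Bool) (a k : ℕ) :
    ∑ i ∈ Finset.range k, spin (w (a + i)) = 2 * cnt w a (a + k) - k := by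
  have h : ∀ b : Bool, spin b = 2 * (if b = true then 1 else 0) - 1 := by
    intro b; cases b <;> norm_num [spin]
  have h2 : ∑ i ∈ Finset.range k, spin (w (a + i)) = ∑ i ∈ Finset.Ico a (a + k), spin (w i) := by
    rw [Finset.sum_Ico_eq_sum_range, Nat.add_sub_cancel_left]
  rw [h2]
  simp only [h, Finset.sum_sub_distrib, ← Finset.mul_sum, Finset.sum_boole, cnt]
  simp

/-- The union bound over the events that no block of length `L * 4 ^ i` is heavy, and the
event that all prefixes of these lengths are heavy. -/
lemma card_prefixNormal_le (L n : ℕ) (hn : (2 ^ 11) ^ L ≤ n) :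
    (Set.ncard {w : Fin n → Bool | IsPrefixNormal n (ext w)} : ℝ) ≤
      2 ^ n * (Real.exp (-((L : ℝ) ^ 2 / 32)) + L * Real.exp (-(2 : ℝ) ^ L)) := by
  classical
  have hL : L ≤ 2 ^ L := Nat.lt_two_pow_self.le
  have hsize : ∀ i < L, 2 ^ (8 * L) * (L * 4 ^ i) ≤ n := by
    intro i hi
    calc 2 ^ (8 * L) * (L * 4 ^ i) ≤ 2 ^ (8 * L) * (2 ^ L * 4 ^ L) := by
          gcongr
          norm_num
      _ = (2 ^ 11) ^ L := by
          rw [pow_mul, ← mul_pow, ← mul_pow]; norm_num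
      _ ≤ n := hn
  have hk : ∀ i < L, L * 4 ^ i ≤ n := fun i hi =>
    (Nat.le_mul_of_pos_left _ (by positivity)).trans (hsize i hi)
  let a : Fin n → ℝ := fun x =>
    ∑ i ∈ (Finset.range L).filter (fun i => (x : ℕ) < L * 4 ^ i), (1 / 2 : ℝ) ^ i
  let B : ℕ → Finset (Fin n → Bool) := fun i => Finset.univ.filter fun w =>
    ∀ j < 2 ^ (8 * L), ∑ x ∈ Finset.range (L * 4 ^ i),
      spin (ext w (j * (L * 4 ^ i) + x)) < L * ((2 : ℝ) ^ i / 2)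
  let G : Finset (Fin n → Bool) := Finset.univ.filter fun w =>
    (L : ℝ) ^ 2 / 2 ≤ ∑ x, a x * spin (w x)
  have ha : ∑ x, a x ^ 2 ≤ 4 * (L : ℝ) ^ 2 := by
    calc ∑ x, a x ^ 2 ≤ ∑ x : Fin n, 4 * ∑ i ∈ (Finset.range L).filter
            (fun i => (x : ℕ) < L * 4 ^ i), (1 / 4 : ℝ) ^ i :=
          Finset.sum_le_sum fun x _ => sq_sum_half_pow_le _
      _ = 4 * ∑ i ∈ Finset.range L, ∑ x : Fin n,
            if (x : ℕ) < L * 4 ^ i then (1 / 4 : ℝ) ^ i else 0 := by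
          rw [← Finset.mul_sum, Finset.sum_comm]
          simp only [Finset.sum_filter]
      _ = 4 * ∑ i ∈ Finset.range L, (L : ℝ) := by
          congr 1
          refine Finset.sum_congr rfl fun i hi => ?_
          rw [Fin.sum_univ_eq_sum_range (fun x => if x < L * 4 ^ i then (1 / 4 : ℝ) ^ i else 0),
            ← Finset.sum_filter]
          have : (Finset.range n).filter (fun x => x < L * 4 ^ i) = Finset.range (L * 4 ^ i) := by
            ext x
            have := hk i (Finset.mem_range.mp hi)
            simp only [Finset.mem_filter, Finset.mem_range]
            omega
          rw [this, Finset.sum_const, Finset.card_range, nsmul_eq_mul]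
          push_cast
          rw [mul_assoc, ← mul_pow]
          norm_num
      _ = _ := by simp; ring
  have hG : (G.card : ℝ) ≤ 2 ^ n * Real.exp (-((L : ℝ) ^ 2 / 32)) := by
    refine (card_weighted_sum_ge n a _ _ (1 / 8) (by norm_num) ha).trans (le_of_eq ?_)
    ring_nf
  have hB : ∀ i < L, ((B i).card : ℝ) ≤ 2 ^ n * Real.exp (-(2 : ℝ) ^ L) := by
    intro i hi
    have h1 := two_pow_le_card_heavy (4 ^ i) (2 ^ i) (by positivity)
      (by push_cast; rw [← pow_mul, mul_comm, pow_mul]; norm_num)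
    have h2 : ((heavy (4 ^ i) ((2 : ℝ) ^ i / 2)).card : ℝ) ^ L ≤
        (heavy (L * 4 ^ i) (L * ((2 : ℝ) ^ i / 2))).card := by
      exact_mod_cast card_heavy_pow_le L (4 ^ i) ((2 : ℝ) ^ i / 2)
    have h3 : (1 / 2 ^ 7 : ℝ) ^ L * 2 ^ (L * 4 ^ i) ≤
        (heavy (L * 4 ^ i) (L * ((2 : ℝ) ^ i / 2))).card := by
      refine le_trans ?_ h2
      rw [mul_comm L, pow_mul, ← mul_pow]
      refine pow_le_pow_left₀ (by positivity) ?_ L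
      linarith [pow_pos (two_pos : (0 : ℝ) < 2) (4 ^ i)]
    refine (card_no_heavy_block n _ (2 ^ (8 * L)) _ _ (hsize i hi) h3).trans (le_of_eq ?_)
    congr 3
    push_cast
    rw [pow_mul, ← mul_pow]
    norm_num
  have hsub : {w : Fin n → Bool | IsPrefixNormal n (ext w)} ⊆
      ((G ∪ (Finset.range L).biUnion B : Finset (Fin n → Bool)) : Set (Fin n → Bool)) := by
    intro w hw
    rw [Finset.mem_coe, Finset.mem_union, or_iff_not_imp_right]
    intro hnB
    have hpre : ∀ i < L, L * ((2 : ℝ) ^ i / 2) ≤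
        ∑ x ∈ Finset.range (L * 4 ^ i), spin (ext w x) := by
      intro i hi
      have : w ∉ B i := fun h => hnB (Finset.mem_biUnion.mpr ⟨i, Finset.mem_range.mpr hi, h⟩)
      simp only [B, Finset.mem_filter, Finset.mem_univ, true_and, not_forall, not_lt] at this
      obtain ⟨j, hj, hjt⟩ := this
      refine hjt.trans ?_
      have hle : j * (L * 4 ^ i) + L * 4 ^ i ≤ n := by
        rw [← Nat.succ_mul]
        exact (Nat.mul_le_mul_right _ hj).trans (hsize i hi)
      have hpn : (cnt (ext w) (j * (L * 4 ^ i)) (j * (L * 4 ^ i) + L * 4 ^ i) : ℝ) ≤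
          cnt (ext w) 0 (L * 4 ^ i) := by
        exact_mod_cast hw (L * 4 ^ i) (j * (L * 4 ^ i)) (hk i hi) hle
      have h0 := sum_spin_eq_cnt (ext w) 0 (L * 4 ^ i)
      simp only [zero_add] at h0
      rw [h0, sum_spin_eq_cnt]
      linarith
    simp only [G, Finset.mem_filter, Finset.mem_univ, true_and]
    calc (L : ℝ) ^ 2 / 2 = ∑ i ∈ Finset.range L, (1 / 2 : ℝ) ^ i * (L * ((2 : ℝ) ^ i / 2)) := by
          have : ∀ i : ℕ, (1 / 2 : ℝ) ^ i * (L * ((2 : ℝ) ^ i / 2)) = L / 2 := by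
            intro i
            rw [one_div, inv_pow]
            field_simp
          simp only [this, Finset.sum_const, Finset.card_range, nsmul_eq_mul]
          ring
      _ ≤ ∑ i ∈ Finset.range L, (1 / 2 : ℝ) ^ i *
            ∑ x ∈ Finset.range (L * 4 ^ i), spin (ext w x) :=
          Finset.sum_le_sum fun i hi =>
            mul_le_mul_of_nonneg_left (hpre i (Finset.mem_range.mp hi)) (by positivity)
      _ = ∑ i ∈ Finset.range L, ∑ x : Fin n,
            if (x : ℕ) < L * 4 ^ i then (1 / 2 : ℝ) ^ i * spin (w x) else 0 := by
          refine Finset.sum_congr rfl fun i hi => ?_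
          simp only [← ext_apply w]
          rw [Fin.sum_univ_eq_sum_range
            (fun x => if x < L * 4 ^ i then (1 / 2 : ℝ) ^ i * spin (ext w x) else 0),
            ← Finset.sum_filter]
          have : (Finset.range n).filter (fun x => x < L * 4 ^ i) = Finset.range (L * 4 ^ i) := by
            ext x
            have := hk i (Finset.mem_range.mp hi)
            simp only [Finset.mem_filter, Finset.mem_range]
            omega
          rw [this, Finset.mul_sum]
      _ = _ := by
          rw [Finset.sum_comm]
          refine Finset.sum_congr rfl fun x _ => ?_
          simp only [a, Finset.sum_mul, Finset.sum_filter, ite_mul, zero_mul]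
  have hcard : Set.ncard {w : Fin n → Bool | IsPrefixNormal n (ext w)} ≤
      G.card + ∑ i ∈ Finset.range L, (B i).card := by
    refine (Set.ncard_le_ncard hsub (Finset.finite_toSet _)).trans ?_
    rw [Set.ncard_coe_finset]
    exact (Finset.card_union_le _ _).trans (Nat.add_le_add_left Finset.card_biUnion_le _)
  calc _ ≤ (G.card : ℝ) + ∑ i ∈ Finset.range L, ((B i).card : ℝ) := by exact_mod_cast hcard
    _ ≤ 2 ^ n * Real.exp (-((L : ℝ) ^ 2 / 32)) +
          ∑ _i ∈ Finset.range L, 2 ^ n * Real.exp (-(2 : ℝ) ^ L) :=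
        add_le_add hG (Finset.sum_le_sum fun i hi => hB i (Finset.mem_range.mp hi))
    _ = _ := by
        rw [Finset.sum_const, Finset.card_range, nsmul_eq_mul]
        ring

lemma exp_add_mul_exp_le (L : ℕ) (hL : 8 ≤ L) :
    Real.exp (-((L : ℝ) ^ 2 / 32)) + L * Real.exp (-(2 : ℝ) ^ L) ≤
      Real.exp (-((L : ℝ) ^ 2 / 64)) := by
  have hL' : (8 : ℝ) ≤ L := by exact_mod_cast hL
  have hpow : L + L ^ 2 ≤ 2 ^ L := by
    induction L, hL using Nat.le_induction with
    | base => norm_num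
    | succ L hL ih =>
      have := ih (by exact_mod_cast hL)
      rw [pow_succ 2 L]
      nlinarith
  have hpow' : (L : ℝ) + L ^ 2 ≤ 2 ^ L := by exact_mod_cast hpow
  have h1 : (L : ℝ) * Real.exp (-(2 : ℝ) ^ L) ≤ Real.exp (-((L : ℝ) ^ 2 / 32)) := by
    calc _ ≤ Real.exp L * Real.exp (-(2 : ℝ) ^ L) := by
          gcongr
          linarith [Real.add_one_le_exp (L : ℝ)]
      _ ≤ _ := by
          rw [← Real.exp_add, Real.exp_le_exp]
          nlinarith
  have h2 : Real.exp (-((L : ℝ) ^ 2 / 32)) =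
      Real.exp (-((L : ℝ) ^ 2 / 64)) * Real.exp (-((L : ℝ) ^ 2 / 64)) := by
    rw [← Real.exp_add]; ring_nf
  have h3 : Real.exp (-((L : ℝ) ^ 2 / 64)) ≤ 1 / 2 := by
    rw [Real.exp_neg, one_div]
    refine inv_anti₀ two_pos ?_
    have := Real.add_one_le_exp ((L : ℝ) ^ 2 / 64)
    nlinarith
  nlinarith [Real.exp_pos (-((L : ℝ) ^ 2 / 64))]

/-- There exists a constant `c > 0` such that for all sufficiently large `n`,
the number of prefix normal binary words of length `n` is at most
`2 ^ (n - c * (log n)^2)`. -/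
theorem prefix_normal_count_upper_bound :
    ∃ c : ℝ, 0 < c ∧ ∀ᶠ n : ℕ in Filter.atTop,
      (Set.ncard {w : Fin n → Bool | IsPrefixNormal n (ext w)} : ℝ) ≤
        (2 : ℝ) ^ ((n : ℝ) - c * (Real.log n) ^ 2) := by
  refine ⟨1 / (64 * 484), by norm_num, ?_⟩
  filter_upwards [Filter.eventually_ge_atTop ((2 ^ 11) ^ 8)] with n hn
  have hn0 : n ≠ 0 := by
    have : 0 < (2 ^ 11) ^ 8 := by positivity
    omega
  obtain ⟨L, hL⟩ : ∃ L, L = Nat.log (2 ^ 11) n := ⟨_, rfl⟩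
  have hL8 : 8 ≤ L := hL ▸ Nat.le_log_of_pow_le (by norm_num) hn
  have hlow : (2 ^ 11) ^ L ≤ n := hL ▸ Nat.pow_log_le_self _ hn0
  have hupp : n < (2 ^ 11) ^ (L + 1) := hL ▸ Nat.lt_pow_succ_log_self (by norm_num) n
  have hL' : (8 : ℝ) ≤ L := by exact_mod_cast hL8
  have hlog2 : Real.log 2 ≤ 1 := by linarith [Real.log_two_lt_d9]
  have hlog0 : 0 ≤ Real.log n := Real.log_natCast_nonneg n
  have hlog : Real.log n ≤ 22 * L := by
    have h1 : (n : ℝ) ≤ (2 ^ 11) ^ (L + 1) := by exact_mod_cast hupp.le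
    have h2 := Real.log_le_log (by positivity) h1
    rw [Real.log_pow, Real.log_pow] at h2
    push_cast at h2
    nlinarith
  refine (card_prefixNormal_le L n hlow).trans ?_
  rw [sub_eq_add_neg, Real.rpow_add two_pos, Real.rpow_natCast]
  refine mul_le_mul_of_nonneg_left ((exp_add_mul_exp_le L hL8).trans ?_) (by positivity)
  rw [Real.rpow_def_of_pos two_pos, Real.exp_le_exp]
  have hsq : Real.log n ^ 2 ≤ 484 * (L : ℝ) ^ 2 := by nlinarith
  nlinarith [mul_nonneg (sub_nonneg.mpr hlog2) (sq_nonneg (Real.log n))]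
end

section
/- There exists a constant C > 0 such that for every sufficiently large n there exists a binary word w of length n for which the number of binary words v of length n with f_v = f_w (equivalently, with the same prefix normal form as w) is at least 2^(n − C·√(n·log n)). -/
/-- The profile `f_w(k)` of a word of length `n`: the maximum number of 1s in
any subword of length `k`, i.e. `max_{0 ≤ j ≤ n-k} |w[j+1, j+k]|₁`. -/
def profile (n : ℕ) (w : ℕ → Bool) (k : ℕ) : ℕ :=
  (Finset.range (n - k + 1)).sup (fun j => cnt w j (j + k))

/-- The number of ones minus the number of zeros in the prefix of length `i`. -/
def excess (w : ℕ → Bool) (i : ℕ) : ℤ :=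
  ∑ j ∈ Finset.range i, if w j = true then 1 else -1

lemma excess_succ (w : ℕ → Bool) (i : ℕ) :
    excess w (i + 1) = excess w i + if w i = true then 1 else -1 :=
  Finset.sum_range_succ _ _

lemma two_mul_cnt (w : ℕ → Bool) (a k : ℕ) :
    2 * (cnt w a (a + k) : ℤ) = k + excess w (a + k) - excess w a := by
  induction k with
  | zero => simp [cnt]
  | succ k ih =>
    have h : (cnt w a (a + (k + 1)) : ℤ) =
        cnt w a (a + k) + if w (a + k) = true then 1 else 0 := by
      unfold cnt
      rw [← add_assoc, Nat.Ico_succ_right_eq_insert_Ico (by omega), Finset.filter_insert]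
      split_ifs <;> simp
    rw [h, ← add_assoc, excess_succ]
    split_ifs <;> push_cast <;> linarith

lemma cnt_le (w : ℕ → Bool) (a k : ℕ) : cnt w a (a + k) ≤ k := by
  simpa [cnt] using Finset.card_filter_le (Finset.Ico a (a + k)) (fun i => w i = true)

lemma profile_congr {n k : ℕ} (hk : k ≤ n) {w w' : ℕ → Bool} (h : ∀ i < n, w i = w' i) :
    profile n w k = profile n w' k := by
  unfold profile cnt
  refine Finset.sup_congr rfl fun j hj => ?_
  congr 1
  refine Finset.filter_congr fun i hi => ?_
  simp only [Finset.mem_range, Finset.mem_Ico] at hi hj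
  rw [h i (by omega)]

/-- A word consisting of an alternating prefix of length `A`, a run of `m` ones, and `t` blocks of
length `L` whose excess walk stays between `0` and `m` and returns to `m` at block boundaries has
a profile that depends only on `m`. -/
lemma profile_eq_of_excess {n A m L t : ℕ} {w : ℕ → Bool} (hn : n = A + m + t * L) (hL : 0 < L)
    (hA : L ≤ A) (hpre : ∀ a ≤ A, excess w a = (a % 2 : ℕ))
    (hones : ∀ i, A ≤ i → i < A + m → w i = true)
    (hnonneg : ∀ i ≤ n, 0 ≤ excess w i) (hle : ∀ i ≤ n, excess w i ≤ m)
    (hbdry : ∀ q ≤ t, excess w (A + m + q * L) = m) {k : ℕ} (hk : k ≤ n) :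
    profile n w k = if k ≤ m then k else (k + m) / 2 := by
  apply le_antisymm
  · refine Finset.sup_le fun j hj => ?_
    rw [Finset.mem_range] at hj
    have h := two_mul_cnt w j k
    have h₁ := cnt_le w j k
    have h₂ := hnonneg j (by omega)
    have h₃ := hle (j + k) (by omega)
    split_ifs <;> omega
  · split_ifs with hkm
    · have h : cnt w A (A + k) = k := by
        unfold cnt
        rw [Finset.filter_true_of_mem]
        · simp
        · intro i hi
          rw [Finset.mem_Ico] at hi
          exact hones i hi.1 (by omega)
      calc k = cnt w A (A + k) := h.symm
        _ ≤ _ := Finset.le_sup (f := fun j => cnt w j (j + k))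
          (Finset.mem_range.2 (by omega))
    · obtain ⟨q, hqt, hq₁, hq₂⟩ : ∃ q ≤ t, m + q * L ≤ k ∧ k ≤ A + m + q * L := by
        have h₁ : (k - m) / L * L ≤ k - m := Nat.div_mul_le_self _ _
        have h₂ : k - m < (k - m) / L * L + L := Nat.lt_div_mul_add hL
        rcases le_total t ((k - m) / L) with h | h
        · have := Nat.mul_le_mul_right L h
          exact ⟨t, le_rfl, by omega, by omega⟩
        · exact ⟨_, h, by omega, by omega⟩
      have hqL := Nat.mul_le_mul_right L hqt
      have h := two_mul_cnt w (A + m + q * L - k) k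
      rw [Nat.sub_add_cancel hq₂, hbdry q hqt, hpre _ (by omega)] at h
      have h₁ := cnt_le w (A + m + q * L - k) k
      calc (k + m) / 2 ≤ cnt w (A + m + q * L - k) (A + m + q * L - k + k) := by
            rw [Nat.sub_add_cancel hq₂]
            omega
        _ ≤ _ := Finset.le_sup (f := fun j => cnt w j (j + k))
          (Finset.mem_range.2 (by omega))

/-- The word `1010…` of length `A`, followed by `m` ones, followed by the Dyck words
`P 0, P 1, …`, each taken to have length `L`, with up-steps read as zeros. -/
def dyckBlockWord (A m L : ℕ) (P : ℕ → DyckWord) (i : ℕ) : Bool :=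
  if i < A then decide (i % 2 = 0) else if i < A + m then true else
    decide ((P ((i - A - m) / L)).toList[(i - A - m) % L]? = some DyckStep.D)

section DyckBlockWord

variable {A m L : ℕ} {P : ℕ → DyckWord}

lemma dyckBlockWord_block (q : ℕ) {r : ℕ} (hr : r < L) :
    dyckBlockWord A m L P (A + m + q * L + r) =
      decide ((P q).toList[r]? = some DyckStep.D) := by
  have h : A + m + q * L + r - A - m = r + L * q := by
    rw [mul_comm]; omega
  rw [dyckBlockWord, if_neg (by omega), if_neg (by omega), h,
    Nat.add_mul_div_left _ _ (by omega), Nat.add_mul_mod_self_left, Nat.mod_eq_of_lt hr,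
    Nat.div_eq_of_lt hr, zero_add]

lemma excess_dyckBlockWord_prefix {a : ℕ} (ha : a ≤ A) :
    excess (dyckBlockWord A m L P) a = (a % 2 : ℕ) := by
  induction a with
  | zero => simp [excess]
  | succ a ih =>
    have hw : dyckBlockWord A m L P a = decide (a % 2 = 0) := if_pos (by omega)
    rw [excess_succ, ih (by omega), hw]
    simp only [decide_eq_true_eq]
    split_ifs <;> omega

lemma excess_dyckBlockWord_ones (hA : A % 2 = 0) {r : ℕ} (hr : r ≤ m) :
    excess (dyckBlockWord A m L P) (A + r) = r := by
  induction r with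
  | zero => simp [excess_dyckBlockWord_prefix, hA]
  | succ r ih =>
    have hw : dyckBlockWord A m L P (A + r) = true := by
      rw [dyckBlockWord, if_neg (by omega), if_pos (by omega)]
    rw [← add_assoc, excess_succ, ih (by omega), hw]
    simp

lemma excess_dyckBlockWord_block (q : ℕ) (hP : (P q).toList.length = L) {r : ℕ} (hr : r ≤ L) :
    excess (dyckBlockWord A m L P) (A + m + q * L + r) =
      excess (dyckBlockWord A m L P) (A + m + q * L) +
        ((P q).toList.take r).count DyckStep.D - ((P q).toList.take r).count DyckStep.U := by
  induction r with
  | zero => simp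
  | succ r ih =>
    rw [← add_assoc, excess_succ, ih (by omega), dyckBlockWord_block q (by omega),
      List.take_add_one, List.getElem?_eq_getElem (by omega)]
    rcases ((P q).toList[r]'(by omega)).dichotomy with h | h <;> simp [h] <;> ring

variable {h t : ℕ}

lemma excess_dyckBlockWord_boundary (hA : A % 2 = 0)
    (hP : ∀ q < t, (P q).semilength = h) {q : ℕ} (hq : q ≤ t) :
    excess (dyckBlockWord A m (2 * h) P) (A + m + q * (2 * h)) = m := by
  induction q with
  | zero => simpa using excess_dyckBlockWord_ones (P := P) (L := 2 * h) hA le_rfl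
  | succ q ih =>
    have hlen : (P q).toList.length = 2 * h := by
      rw [← (P q).two_mul_semilength_eq_length, hP q (by omega)]
    rw [add_mul, one_mul, ← add_assoc, excess_dyckBlockWord_block q hlen le_rfl, ih (by omega),
      List.take_of_length_le hlen.le, (P q).count_U_eq_count_D]
    ring

lemma profile_dyckBlockWord (hh : 0 < h) (hm : h ≤ m) (hA : A % 2 = 0) (hLA : 2 * h ≤ A)
    (hP : ∀ q < t, (P q).semilength = h) {n : ℕ} (hn : n = A + m + t * (2 * h))
    {k : ℕ} (hk : k ≤ n) :
    profile n (dyckBlockWord A m (2 * h) P) k = if k ≤ m then k else (k + m) / 2 := by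
  have hbound : ∀ i ≤ n, 0 ≤ excess (dyckBlockWord A m (2 * h) P) i ∧
      excess (dyckBlockWord A m (2 * h) P) i ≤ m := by
    intro i hi
    rcases le_total i A with h₁ | h₁
    · rw [excess_dyckBlockWord_prefix h₁]
      omega
    rcases le_or_gt i (A + m) with h₂ | h₂
    · obtain ⟨r, rfl⟩ := Nat.exists_eq_add_of_le h₁
      rw [excess_dyckBlockWord_ones hA (by omega)]
      omega
    obtain ⟨s, rfl⟩ := Nat.exists_eq_add_of_lt h₂
    obtain ⟨q, r, hr, hs⟩ : ∃ q r, r < 2 * h ∧ s = q * (2 * h) + r :=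
      ⟨s / (2 * h), s % (2 * h), Nat.mod_lt _ (by omega), (Nat.div_add_mod' _ _).symm⟩
    have hqt : q < t := by
      by_contra! hc
      have := Nat.mul_le_mul_right (2 * h) hc
      omega
    have hlen : (P q).toList.length = 2 * h := by
      rw [← (P q).two_mul_semilength_eq_length, hP q hqt]
    rw [show A + m + s + 1 = A + m + q * (2 * h) + (r + 1) by omega,
      excess_dyckBlockWord_block q hlen (by omega), excess_dyckBlockWord_boundary hA hP hqt.le]
    have h₃ := (P q).count_D_le_count_U (r + 1)
    have h₄ : ((P q).toList.take (r + 1)).count DyckStep.U ≤ h := by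
      rw [← hP q hqt]
      exact (List.take_sublist _ _).count_le _
    omega
  refine profile_eq_of_excess hn (by omega) hLA (fun a ha => excess_dyckBlockWord_prefix ha)
    (fun i h₁ h₂ => ?_) (fun i hi => (hbound i hi).1) (fun i hi => (hbound i hi).2)
    (fun q hq => excess_dyckBlockWord_boundary hA hP hq) hk
  rw [dyckBlockWord, if_neg (by omega), if_pos h₂]

end DyckBlockWord

lemma exists_catalan_pow_le_ncard {n h m A t : ℕ} (hh : 0 < h) (hm : h ≤ m) (hA : A % 2 = 0)
    (hLA : 2 * h ≤ A) (hn : n = A + m + t * (2 * h)) :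
    ∃ w : Fin n → Bool, catalan h ^ t ≤ Set.ncard {v : Fin n → Bool |
      ∀ k ≤ n, profile n (ext v) k = profile n (ext w) k} := by
  let blocks (P : Fin t → {p : DyckWord // p.semilength = h}) (q : ℕ) : DyckWord :=
    if hq : q < t then P ⟨q, hq⟩ else 0
  let word (P : Fin t → {p : DyckWord // p.semilength = h}) (i : Fin n) : Bool :=
    dyckBlockWord A m (2 * h) (blocks P) i
  have hblocks (P) (q) (hq : q < t) : (blocks P q).semilength = h := by
    simp only [blocks, dif_pos hq]
    exact (P ⟨q, hq⟩).2
  have hprofile (P) (k) (hk : k ≤ n) :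
      profile n (ext (word P)) k = if k ≤ m then k else (k + m) / 2 := by
    rw [← profile_dyckBlockWord hh hm hA hLA (hblocks P) hn hk]
    exact profile_congr hk fun i hi => by simp [ext, hi, word]
  have hinj : Function.Injective word := by
    intro P Q hPQ
    funext q
    have hlen (R : Fin t → {p : DyckWord // p.semilength = h}) : (R q).1.toList.length = 2 * h := by
      rw [← DyckWord.two_mul_semilength_eq_length, (R q).2]
    refine Subtype.ext (DyckWord.ext (List.ext_getElem ((hlen P).trans (hlen Q).symm) ?_))
    intro r h₁ h₂
    have hr : r < 2 * h := hlen P ▸ h₁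
    have hlt : A + m + q * (2 * h) + r < n := by
      have := Nat.mul_le_mul_right (2 * h) (Nat.succ_le_of_lt q.2)
      rw [Nat.succ_mul] at this
      omega
    have key := congrFun hPQ ⟨_, hlt⟩
    simp only [word, dyckBlockWord_block _ hr, blocks, q.2, dif_pos, Fin.eta,
      List.getElem?_eq_getElem h₁, List.getElem?_eq_getElem h₂, Option.some.injEq,
      decide_eq_decide] at key
    rcases ((P q).1.toList[r]).dichotomy with hp | hp <;>
      rcases ((Q q).1.toList[r]).dichotomy with hq | hq <;> simp_all
  have hcard : (Set.range word).ncard = catalan h ^ t := by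
    rw [← Set.image_univ, Set.ncard_image_of_injective _ hinj, Set.ncard_univ,
      Nat.card_eq_fintype_card, Fintype.card_fun, Fintype.card_fin,
      DyckWord.card_dyckWord_semilength_eq_catalan]
  have hne : Nonempty (Fin t → {p : DyckWord // p.semilength = h}) := by
    have : 0 < Fintype.card {p : DyckWord // p.semilength = h} := by
      rw [DyckWord.card_dyckWord_semilength_eq_catalan]
      refine Nat.pos_of_ne_zero fun h₀ => ?_
      have := succ_mul_catalan_eq_centralBinom h
      have := Nat.centralBinom_pos h
      simp_all
    exact ⟨fun _ => (Fintype.card_pos_iff.1 this).some⟩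
  refine ⟨word hne.some, hcard ▸ Set.ncard_le_ncard ?_ (Set.toFinite _)⟩
  rintro _ ⟨P, rfl⟩ k hk
  rw [hprofile P k hk, hprofile _ k hk]

lemma two_pow_le_sq_mul_catalan {h : ℕ} (hh : 0 < h) :
    2 ^ (2 * h) ≤ (2 * h) ^ 2 * catalan h := by
  calc 2 ^ (2 * h) = 4 ^ h := by rw [pow_mul]; norm_num
    _ ≤ 2 * h * h.centralBinom := Nat.four_pow_le_two_mul_self_mul_centralBinom h hh
    _ = 2 * h * (h + 1) * catalan h := by rw [← succ_mul_catalan_eq_centralBinom]; ring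
    _ ≤ (2 * h) ^ 2 * catalan h := Nat.mul_le_mul_right _ (by nlinarith)

lemma natCast_le_two_rpow {n : ℕ} (hn : 0 < n) : (n : ℝ) ≤ 2 ^ (2 * Real.log n) := by
  have hn' : (1 : ℝ) ≤ n := by exact_mod_cast hn
  have h₁ := Real.log_nonneg hn'
  have h₂ := Real.log_two_gt_d9
  rw [Real.rpow_def_of_pos two_pos]
  calc (n : ℝ) = Real.exp (Real.log n) := (Real.exp_log (by linarith)).symm
    _ ≤ _ := Real.exp_le_exp.2 (by nlinarith)

/-- There exists a constant `C > 0` such that for every sufficiently large `n`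
there is a binary word `w` of length `n` for which the number of binary words
`v` of length `n` with the same profile (equivalently, the same prefix normal
form) is at least `2 ^ (n - C * √(n * log n))`. -/
theorem max_class_size_lower_bound :
    ∃ C : ℝ, 0 < C ∧ ∀ᶠ n : ℕ in Filter.atTop, ∃ w : Fin n → Bool,
      (2 : ℝ) ^ ((n : ℝ) - C * Real.sqrt ((n : ℝ) * Real.log n)) ≤
        (Set.ncard {v : Fin n → Bool |
          ∀ k ≤ n, profile n (ext v) k = profile n (ext w) k} : ℝ) := by
  refine ⟨18, by norm_num, ?_⟩
  have hlog : ∀ᶠ n : ℕ in Filter.atTop, Real.log n ≤ 1 / 144 * n := by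
    have := (Real.isLittleO_log_id_atTop.comp_tendsto
      tendsto_natCast_atTop_atTop).bound (show (0 : ℝ) < 1 / 144 by norm_num)
    filter_upwards [this] with n hn
    simpa using (le_abs_self _).trans hn
  filter_upwards [hlog, Filter.eventually_ge_atTop 3] with n hn hn3
  have hn3' : (3 : ℝ) ≤ n := by exact_mod_cast hn3
  have hlog1 : 1 ≤ Real.log n := by
    rw [Real.le_log_iff_exp_le (by linarith)]
    linarith [Real.exp_one_lt_d9]
  set x := Real.sqrt (n * Real.log n) with hx
  have hxsq : x ^ 2 = n * Real.log n := Real.sq_sqrt (by positivity)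
  have hx1 : 1 ≤ x := Real.one_le_sqrt.2 (by nlinarith)
  have hxn : 12 * x ≤ n := by
    refine abs_le_of_sq_le_sq' ?_ (by linarith) |>.2
    nlinarith
  set h := ⌈x⌉₊ with hh
  have hxh : x ≤ h := Nat.le_ceil x
  have hhx : (h : ℝ) ≤ 2 * x := by linarith [Nat.ceil_lt_add_one (show 0 ≤ x by linarith)]
  have hpos : 0 < h := Nat.ceil_pos.2 (by linarith)
  have h6 : 6 * h ≤ n := by
    have : (6 * h : ℝ) ≤ n := by linarith
    exact_mod_cast this
  have h3 : 3 ≤ n / (2 * h) := (Nat.le_div_iff_mul_le (by omega)).2 (by omega)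
  obtain ⟨t, ht⟩ := Nat.exists_eq_add_of_le h3
  have hlow : n / (2 * h) * (2 * h) ≤ n := Nat.div_mul_le_self _ _
  have hupp : n < n / (2 * h) * (2 * h) + 2 * h := Nat.lt_div_mul_add (by omega)
  rw [ht, add_mul] at hlow hupp
  have hparity : t * (2 * h) = 2 * (t * h) := by ring
  obtain ⟨w, hw⟩ := exists_catalan_pow_le_ncard (n := n) (h := h) (m := 2 * h + n % 2)
    (A := n - (2 * h + n % 2) - t * (2 * h)) (t := t) hpos (by omega) (by omega) (by omega)
    (by omega)
  refine ⟨w, le_trans ?_ (Nat.cast_le.2 hw)⟩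
  have hcat : (2 : ℝ) ^ (t * (2 * h)) ≤ ((2 * h : ℕ) : ℝ) ^ (2 * t) * (catalan h : ℝ) ^ t := by
    have := Nat.pow_le_pow_left (two_pow_le_sq_mul_catalan hpos) t
    rw [mul_pow, ← pow_mul, ← pow_mul, mul_comm (2 * h) t] at this
    exact_mod_cast this
  have htlog : t * Real.log n ≤ x / 2 := by
    have h₁ : (t * (2 * h) : ℝ) ≤ n := by
      have : t * (2 * h) ≤ n := by omega
      exact_mod_cast this
    have h₂ : (t * (2 * x) : ℝ) ≤ n := le_trans (by gcongr) h₁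
    have h₃ : t * (2 * x) * Real.log n ≤ x ^ 2 := hxsq ▸ by gcongr
    nlinarith
  have hsq : ((2 * h : ℕ) : ℝ) ^ (2 * t) ≤ 2 ^ (2 * x) := by
    calc ((2 * h : ℕ) : ℝ) ^ (2 * t) ≤ (n : ℝ) ^ (2 * t) := by
          gcongr
          omega
      _ ≤ ((2 : ℝ) ^ (2 * Real.log n)) ^ (2 * t) := by
          gcongr
          exact natCast_le_two_rpow (by omega)
      _ = (2 : ℝ) ^ (4 * (t * Real.log n)) := by
          rw [← Real.rpow_natCast, ← Real.rpow_mul two_pos.le]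
          congr 1
          push_cast
          ring
      _ ≤ 2 ^ (2 * x) := Real.rpow_le_rpow_of_exponent_le one_le_two (by linarith)
  have hlen : (n : ℝ) - 16 * x ≤ (t * (2 * h) : ℕ) := by
    have : (n : ℝ) ≤ (t * (2 * h) + 8 * h : ℕ) := by
      exact_mod_cast (show n ≤ t * (2 * h) + 8 * h by omega)
    push_cast at this ⊢
    linarith
  push_cast
  have hfinal : (2 : ℝ) ^ ((n : ℝ) - 18 * x) * 2 ^ (2 * x) ≤ catalan h ^ t * 2 ^ (2 * x) := by
    calc (2 : ℝ) ^ ((n : ℝ) - 18 * x) * 2 ^ (2 * x) = 2 ^ ((n : ℝ) - 16 * x) := by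
          rw [← Real.rpow_add two_pos]
          congr 1
          ring
      _ ≤ (2 : ℝ) ^ ((t * (2 * h) : ℕ) : ℝ) :=
          Real.rpow_le_rpow_of_exponent_le one_le_two hlen
      _ = (2 : ℝ) ^ (t * (2 * h)) := Real.rpow_natCast _ _
      _ ≤ _ := hcat
      _ ≤ 2 ^ (2 * x) * (catalan h : ℝ) ^ t := by gcongr
      _ = _ := mul_comm _ _
  exact le_of_mul_le_mul_right hfinal (by positivity)
end
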